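/- arXiv:2308.14642 — 7 statements merged into one kernel-verified Lean document; each statement's English description precedes it below -/
import Mathlib

section
/- Let d ≥ 1 and K ≥ 1 be integers, let φ_1, …, φ_K ∈ ℝ^d satisfy ‖φ_k‖ ≤ 1 for all k, let λ ≥ 1, and define Λ_k = λI + Σ_{i=1}^{k−1} φ_i φ_iᵀ for k = 1,…,K. Then Σ_{k=1}^K ‖φ_k‖²_{Λ_k^{-1}} ≤ 2d·log(1 + K/(dλ)). -/
open Matrix Finset

section EllipticalPotential

variable {n : Type*} [DecidableEq n]

/-- The regularized Gram matrix of the first `k` vectors of a sequence. -/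
def regGram (lam : ℝ) (ψ : ℕ → n → ℝ) (k : ℕ) : Matrix n n ℝ :=
  lam • (1 : Matrix n n ℝ) + ∑ i ∈ range k, vecMulVec (ψ i) (ψ i)

theorem regGram_zero (lam : ℝ) (ψ : ℕ → n → ℝ) : regGram lam ψ 0 = lam • 1 := by
  simp [regGram]

theorem regGram_succ (lam : ℝ) (ψ : ℕ → n → ℝ) (k : ℕ) :
    regGram lam ψ (k + 1) = regGram lam ψ k + vecMulVec (ψ k) (ψ k) := by
  simp [regGram, sum_range_succ, add_assoc]

variable [Fintype n]

theorem regGram_sub_smul_one_posSemidef (lam : ℝ) (ψ : ℕ → n → ℝ) (k : ℕ) :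
    (regGram lam ψ k - lam • 1).PosSemidef := by
  rw [regGram, add_sub_cancel_left]
  exact posSemidef_sum _ fun i _ => by simpa using posSemidef_vecMulVec_self_star (ψ i)

theorem regGram_posDef {lam : ℝ} (hlam : 0 < lam) (ψ : ℕ → n → ℝ) (k : ℕ) :
    (regGram lam ψ k).PosDef := by
  have h : (lam • (1 : Matrix n n ℝ)).PosDef := PosDef.one.smul hlam
  simpa using h.add_posSemidef (regGram_sub_smul_one_posSemidef lam ψ k)

theorem trace_regGram (lam : ℝ) (ψ : ℕ → n → ℝ) (k : ℕ) :
    (regGram lam ψ k).trace = Fintype.card n * lam + ∑ i ∈ range k, ψ i ⬝ᵥ ψ i := by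
  simp [regGram, trace_add, trace_sum, trace_vecMulVec, mul_comm]

/-- Matrix determinant lemma for a symmetric rank-one update. -/
theorem Matrix.PosDef.det_add_vecMulVec_self {A : Matrix n n ℝ} (hA : A.PosDef) (v : n → ℝ) :
    (A + vecMulVec v v).det = A.det * (1 + v ⬝ᵥ A⁻¹ *ᵥ v) := by
  have hu : IsUnit A.det := hA.det_pos.ne'.isUnit
  rw [vecMulVec_eq Unit, det_add_replicateCol_mul_replicateRow hu]
  congr 1
  rw [dotProduct_mulVec]
  simp [mul_apply, dotProduct, vecMul]

/-- If `A ≥ 1` in the Loewner order, then `‖v‖²_{A⁻¹} ≤ ‖v‖²`. -/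
theorem Matrix.PosDef.dotProduct_inv_mulVec_le {A : Matrix n n ℝ} (hA : A.PosDef)
    (h : (A - 1).PosSemidef) (v : n → ℝ) : v ⬝ᵥ A⁻¹ *ᵥ v ≤ v ⬝ᵥ v := by
  have hu : IsUnit A.det := hA.det_pos.ne'.isUnit
  set w := A⁻¹ *ᵥ v with hw
  have hv : A *ᵥ w = v := by rw [hw, mulVec_mulVec, mul_nonsing_inv _ hu, one_mulVec]
  have h1 := h.dotProduct_mulVec_nonneg w
  rw [star_trivial, sub_mulVec, one_mulVec, hv, dotProduct_sub, dotProduct_comm w v] at h1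
  have h2 := dotProduct_star_self_nonneg (v - w)
  rw [star_trivial, sub_dotProduct, dotProduct_sub, dotProduct_sub, dotProduct_comm w v] at h2
  linarith

/-- The tangent-line form of the arithmetic-geometric mean inequality for eigenvalues. -/
theorem Matrix.PosDef.log_det_le {A : Matrix n n ℝ} (hA : A.PosDef) {c : ℝ} (hc : 0 < c) :
    Real.log A.det ≤ A.trace / c - Fintype.card n + Fintype.card n * Real.log c := by
  have hpos := hA.eigenvalues_pos
  have hdet : A.det = ∏ i, hA.1.eigenvalues i := by simpa using hA.1.det_eq_prod_eigenvalues
  have htr : A.trace = ∑ i, hA.1.eigenvalues i := by simpa using hA.1.trace_eq_sum_eigenvalues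
  rw [hdet, htr, Real.log_prod fun i _ => (hpos i).ne']
  calc ∑ i, Real.log (hA.1.eigenvalues i)
      ≤ ∑ i, (hA.1.eigenvalues i / c - 1 + Real.log c) := by
        refine sum_le_sum fun i _ => ?_
        have := Real.log_le_sub_one_of_pos (div_pos (hpos i) hc)
        rw [Real.log_div (hpos i).ne' hc.ne'] at this
        linarith
    _ = _ := by simp [sum_add_distrib, sum_sub_distrib, sum_div]

theorem Real.le_two_mul_log_one_add {x : ℝ} (h0 : 0 ≤ x) (h1 : x ≤ 1) :
    x ≤ 2 * Real.log (1 + x) := by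
  have h := Real.le_log_one_add_of_nonneg h0
  have : x / 2 ≤ 2 * x / (x + 2) := by
    rw [div_le_div_iff₀ (by norm_num) (by linarith)]
    nlinarith
  linarith

theorem sum_dotProduct_inv_regGram_le_log_det {lam : ℝ} (hlam : 1 ≤ lam) {ψ : ℕ → n → ℝ}
    (hψ : ∀ i, ψ i ⬝ᵥ ψ i ≤ 1) (k : ℕ) :
    ∑ i ∈ range k, ψ i ⬝ᵥ (regGram lam ψ i)⁻¹ *ᵥ ψ i ≤
      2 * (Real.log (regGram lam ψ k).det - Fintype.card n * Real.log lam) := by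
  have hpos : 0 < lam := by linarith
  induction k with
  | zero => simp [regGram_zero]
  | succ k ih =>
    have hA := regGram_posDef hpos ψ k
    have hge : (regGram lam ψ k - 1).PosSemidef := by
      have h1 : ((lam - 1) • (1 : Matrix n n ℝ)).PosSemidef :=
        PosSemidef.one.smul (sub_nonneg.2 hlam)
      have := (regGram_sub_smul_one_posSemidef lam ψ k).add h1
      rwa [sub_smul, one_smul, sub_add_sub_cancel] at this
    have h0 : 0 ≤ ψ k ⬝ᵥ (regGram lam ψ k)⁻¹ *ᵥ ψ k := by
      simpa using hA.inv.posSemidef.dotProduct_mulVec_nonneg (ψ k)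
    have h1 := (hA.dotProduct_inv_mulVec_le hge (ψ k)).trans (hψ k)
    have h2 := Real.le_two_mul_log_one_add h0 h1
    rw [sum_range_succ, regGram_succ, hA.det_add_vecMulVec_self,
      Real.log_mul hA.det_pos.ne' (by linarith)]
    linarith

/-- The elliptical potential lemma for sequences. -/
theorem sum_dotProduct_inv_regGram_le [Nonempty n] {lam : ℝ} (hlam : 1 ≤ lam) {ψ : ℕ → n → ℝ}
    (hψ : ∀ i, ψ i ⬝ᵥ ψ i ≤ 1) (k : ℕ) :
    ∑ i ∈ range k, ψ i ⬝ᵥ (regGram lam ψ i)⁻¹ *ᵥ ψ i ≤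
      2 * Fintype.card n * Real.log (1 + k / (Fintype.card n * lam)) := by
  have hpos : 0 < lam := by linarith
  have hd : (0 : ℝ) < Fintype.card n := by exact_mod_cast Fintype.card_pos
  have hc : 0 < lam + k / Fintype.card n := by positivity
  have htr : (regGram lam ψ k).trace / (lam + k / Fintype.card n) ≤ Fintype.card n := by
    have hsum : ∑ i ∈ range k, ψ i ⬝ᵥ ψ i ≤ k := by
      simpa using sum_le_sum fun i (_ : i ∈ range k) => hψ i
    rw [div_le_iff₀ hc, trace_regGram, mul_add, mul_div_cancel₀ _ hd.ne']
    linarith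
  have hlog : Real.log (1 + k / (Fintype.card n * lam)) =
      Real.log (lam + k / Fintype.card n) - Real.log lam := by
    rw [← Real.log_div hc.ne' hpos.ne']
    congr 1
    field_simp
  have h1 := sum_dotProduct_inv_regGram_le_log_det hlam hψ k
  have h2 := (regGram_posDef hpos ψ k).log_det_le hc
  rw [hlog]
  linarith

end EllipticalPotential

/-- Elliptical potential lemma: with `Λ_k = λ•I + ∑_{i<k} φ_i φ_iᵀ`, `λ ≥ 1` and `‖φ_k‖ ≤ 1`,
the sum of the squared weighted norms `‖φ_k‖²_{Λ_k⁻¹}` is at most `2d log(1 + K/(dλ))`. -/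
theorem stmt_0 (d K : ℕ) (hd : 1 ≤ d) (hK : 1 ≤ K)
    (φ : Fin K → Fin d → ℝ)
    (hφ : ∀ k, Real.sqrt (∑ i, φ k i ^ 2) ≤ 1)
    (lam : ℝ) (hlam : 1 ≤ lam)
    (Λ : Fin K → Matrix (Fin d) (Fin d) ℝ)
    (hΛ : ∀ k, Λ k = lam • (1 : Matrix (Fin d) (Fin d) ℝ)
      + ∑ i ∈ Finset.Iio k, Matrix.vecMulVec (φ i) (φ i)) :
    ∑ k, φ k ⬝ᵥ (Λ k)⁻¹.mulVec (φ k) ≤ 2 * d * Real.log (1 + K / (d * lam)) := by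
  have : Nonempty (Fin d) := ⟨⟨0, hd⟩⟩
  set ψ : ℕ → Fin d → ℝ := fun i => if h : i < K then φ ⟨i, h⟩ else 0 with hψdef
  have hψφ (k : Fin K) : ψ k = φ k := by simp [hψdef]
  have hψ (i : ℕ) : ψ i ⬝ᵥ ψ i ≤ 1 := by
    by_cases h : i < K
    · have := Real.sqrt_le_iff.1 (hφ ⟨i, h⟩) |>.2
      simpa [hψdef, h, dotProduct, sq] using this
    · simp [hψdef, h]
  have hgram (k : Fin K) : Λ k = regGram lam ψ k := by
    rw [hΛ, regGram, ← Nat.Iio_eq_range, ← Fin.map_valEmbedding_Iio, sum_map]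
    simp [hψφ]
  have := sum_dotProduct_inv_regGram_le hlam hψ K
  rw [← Fin.sum_univ_eq_sum_range (fun i => ψ i ⬝ᵥ (regGram lam ψ i)⁻¹ *ᵥ ψ i)] at this
  simpa [hψφ, hgram] using this
end

section
/- Let A, B ∈ ℝ^{d×d} be symmetric matrices with A positive definite and A ⪯ B. Then B ⪯ (det B / det A) · A. -/
open Matrix

open scoped MatrixOrder in
/-- A positive definite matrix factors as `star S * S` with `S` invertible. -/
theorem Matrix.PosDef.exists_isUnit_eq_star_mul_self {n : Type*} [Fintype n] [DecidableEq n]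
    {A : Matrix n n ℝ} (hA : A.PosDef) : ∃ S : Matrix n n ℝ, IsUnit S ∧ A = star S * S := by
  obtain ⟨S, hS⟩ := CStarAlgebra.nonneg_iff_eq_star_mul_self.mp hA.posSemidef.nonneg
  have hu : IsUnit (star S * S).det := hS ▸ (isUnit_iff_isUnit_det A).mp hA.isUnit
  rw [det_mul] at hu
  exact ⟨S, (isUnit_iff_isUnit_det S).mpr (isUnit_of_mul_isUnit_right hu), hS⟩

/-- If `1 ⪯ C` then `C ⪯ det C • 1`: each eigenvalue is at most the product of all of them,
since all are at least one. -/
theorem Matrix.posSemidef_det_smul_one_sub {n : Type*} [Fintype n] [DecidableEq n]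
    {C : Matrix n n ℝ} (hC : (C - 1).PosSemidef) : (C.det • 1 - C).PosSemidef := by
  have hH : C.IsHermitian := by simpa using hC.isHermitian.add isHermitian_one
  set U : Matrix n n ℝ := hH.eigenvectorUnitary.1
  have hUU : U * star U = 1 := Unitary.mul_star_self_of_mem hH.eigenvectorUnitary.2
  have hU : IsUnit U := IsUnit.of_mul_eq_one _ hUU
  have hspec : C = U * diagonal hH.eigenvalues * star U := by
    simpa [Unitary.conjStarAlgAut_apply] using hH.spectral_theorem
  have hone (i : n) : 1 ≤ hH.eigenvalues i := by
    have h : C - 1 = U * diagonal (fun i => hH.eigenvalues i - 1) * star U := by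
      rw [← diagonal_sub, mul_sub, sub_mul, ← hspec, diagonal_one, mul_one, hUU]
    rw [h, IsUnit.posSemidef_star_right_conjugate_iff hU, posSemidef_diagonal_iff] at hC
    linarith [hC i]
  have hdet : C.det = ∏ i, hH.eigenvalues i := by simpa using hH.det_eq_prod_eigenvalues
  have h : C.det • 1 - C = U * diagonal (fun i => C.det - hH.eigenvalues i) * star U := by
    rw [← diagonal_sub, mul_sub, sub_mul, ← hspec, ← smul_one_eq_diagonal, mul_smul_comm,
      smul_mul_assoc, mul_one, hUU]
  rw [h, IsUnit.posSemidef_star_right_conjugate_iff hU, posSemidef_diagonal_iff]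
  intro i
  rw [hdet, sub_nonneg, ← Finset.mul_prod_erase _ _ (Finset.mem_univ i)]
  exact le_mul_of_one_le_right (by linarith [hone i]) (Finset.one_le_prod fun j _ => hone j)

/-- If `A` is positive definite, `B` symmetric, and `A ⪯ B` in the Loewner order,
then `B ⪯ (det B / det A) • A`. -/
theorem stmt_1 (d : ℕ) (A B : Matrix (Fin d) (Fin d) ℝ)
    (hA : A.PosDef) (hB : B.IsHermitian)
    (hAB : (B - A).PosSemidef) :
    ((B.det / A.det) • A - B).PosSemidef := by
  obtain ⟨S, hS, rfl⟩ := hA.exists_isUnit_eq_star_mul_self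
  obtain ⟨C, rfl⟩ : ∃ C, B = star S * C * S := by
    have hinv : S⁻¹ * S = 1 := nonsing_inv_mul S ((isUnit_iff_isUnit_det S).mp hS)
    refine ⟨star S⁻¹ * B * S⁻¹, ?_⟩
    rw [← mul_assoc, ← mul_assoc, ← star_mul, mul_assoc, hinv, star_one, one_mul, mul_one]
  have hdet : (star S * C * S).det / (star S * S).det = C.det := by
    rw [div_eq_iff hA.det_pos.ne']
    simp only [det_mul]
    ring
  have hsub : star S * C * S - star S * S = star S * (C - 1) * S := by
    rw [mul_sub, sub_mul, mul_one]
  rw [hsub, IsUnit.posSemidef_star_left_conjugate_iff hS] at hAB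
  have hgoal : C.det • (star S * S) - star S * C * S = star S * (C.det • 1 - C) * S := by
    rw [mul_sub, sub_mul, mul_smul_comm, smul_mul_assoc, mul_one]
  rw [hdet, hgoal, IsUnit.posSemidef_star_left_conjugate_iff hS]
  exact posSemidef_det_smul_one_sub hAB
end

section
/- Let 𝒜 be a nonempty finite set, p ≥ 1 an integer, and L ≥ 0. For each a ∈ 𝒜 let u_a : ℝ^p → ℝ be an L-Lipschitz function (with respect to the Euclidean norm on ℝ^p). For θ ∈ ℝ^p define the softmax distribution π^θ on 𝒜 by π^θ(a) = exp(u_a(θ)) / Σ_{b∈𝒜} exp(u_b(θ)). Then for all θ, θ′ ∈ ℝ^p: Σ_{a∈𝒜} |π^θ(a) − π^{θ′}(a)| ≤ 2L·‖θ − θ′‖₂. -/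
/-- The logarithmic mean is at most the arithmetic mean, in exponential form. -/
theorem abs_exp_sub_exp_le_mul_arith_mean (x y : ℝ) :
    |Real.exp x - Real.exp y| ≤ |x - y| * ((Real.exp x + Real.exp y) / 2) := by
  wlog h : y ≤ x generalizing x y
  · rw [abs_sub_comm, abs_sub_comm x, add_comm]
    exact this y x (le_of_not_ge h)
  rw [abs_of_nonneg (sub_nonneg.2 (Real.exp_le_exp.2 h)), abs_of_nonneg (sub_nonneg.2 h)]
  have h1 : 1 ≤ Real.exp (x - y) := Real.one_le_exp (sub_nonneg.2 h)
  have h2 := Real.le_log_one_add_of_nonneg (sub_nonneg.2 h1)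
  rw [add_sub_cancel, Real.log_exp, div_le_iff₀ (by linarith)] at h2
  have h3 : Real.exp x = Real.exp (x - y) * Real.exp y := by
    rw [← Real.exp_add, sub_add_cancel]
  rw [h3]
  nlinarith [mul_le_mul_of_nonneg_right h2 (Real.exp_pos y).le]

/-- The log-sum-exp function is 1-Lipschitz for the sup norm (one-sided form). -/
theorem log_sum_exp_sub_le {ι : Type*} [Fintype ι] [Nonempty ι] {x y : ι → ℝ} {D : ℝ}
    (h : ∀ i, x i - y i ≤ D) :
    Real.log (∑ i, Real.exp (x i)) - Real.log (∑ i, Real.exp (y i)) ≤ D := by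
  have hx : 0 < ∑ i, Real.exp (x i) :=
    Finset.sum_pos (fun i _ => Real.exp_pos _) Finset.univ_nonempty
  have hy : 0 < ∑ i, Real.exp (y i) :=
    Finset.sum_pos (fun i _ => Real.exp_pos _) Finset.univ_nonempty
  rw [← Real.log_div hx.ne' hy.ne', Real.log_le_iff_le_exp (div_pos hx hy), div_le_iff₀ hy,
    Finset.mul_sum]
  refine Finset.sum_le_sum fun i _ => ?_
  rw [← Real.exp_add]
  exact Real.exp_le_exp.2 (by linarith [h i])

/-- Softmax policies with `L`-Lipschitz logits are `2L`-Lipschitz in total variation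
(ℓ¹) distance. -/
theorem stmt_3 (𝒜 : Type*) [Fintype 𝒜] [Nonempty 𝒜]
    (p : ℕ) (hp : 1 ≤ p) (L : ℝ) (hL : 0 ≤ L)
    (u : 𝒜 → EuclideanSpace ℝ (Fin p) → ℝ)
    (hu : ∀ a θ θ', |u a θ - u a θ'| ≤ L * ‖θ - θ'‖)
    (π : EuclideanSpace ℝ (Fin p) → 𝒜 → ℝ)
    (hπ : ∀ θ a, π θ a = Real.exp (u a θ) / ∑ b, Real.exp (u b θ))
    (θ θ' : EuclideanSpace ℝ (Fin p)) :
    ∑ a, |π θ a - π θ' a| ≤ 2 * L * ‖θ - θ'‖ := by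
  have hZ : ∀ θ, 0 < ∑ b, Real.exp (u b θ) := fun θ =>
    Finset.sum_pos (fun i _ => Real.exp_pos _) Finset.univ_nonempty
  have hexp : ∀ θ a, π θ a = Real.exp (u a θ - Real.log (∑ b, Real.exp (u b θ))) := by
    intro θ a
    rw [hπ, Real.exp_sub, Real.exp_log (hZ θ)]
  have hsum : ∀ θ, ∑ a, π θ a = 1 := by
    intro θ
    simp_rw [hπ, ← Finset.sum_div]
    exact div_self (hZ θ).ne'
  have hlog := log_sum_exp_sub_le fun a => (abs_le.1 (hu a θ θ')).2
  have hlog' := log_sum_exp_sub_le (x := fun a => u a θ') (y := fun a => u a θ)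
    (D := L * ‖θ - θ'‖) fun a => by linarith [(abs_le.1 (hu a θ θ')).1]
  calc ∑ a, |π θ a - π θ' a|
      ≤ ∑ a, 2 * L * ‖θ - θ'‖ * ((π θ a + π θ' a) / 2) := by
        refine Finset.sum_le_sum fun a _ => ?_
        rw [hexp θ, hexp θ']
        refine (abs_exp_sub_exp_le_mul_arith_mean _ _).trans
          (mul_le_mul_of_nonneg_right ?_ (by positivity))
        obtain ⟨h1, h2⟩ := abs_le.1 (hu a θ θ')
        exact abs_le.2 ⟨by linarith, by linarith⟩
    _ = 2 * L * ‖θ - θ'‖ := by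
        rw [← Finset.mul_sum, ← Finset.sum_div, Finset.sum_add_distrib, hsum, hsum]
        ring
end

section
/- Let 𝒜 be a nonempty finite set, d ≥ 1, J ≥ 1 integers, and K ≥ 1 a real number. Let (x_a)_{a∈𝒜} ⊂ ℝ^d satisfy ‖x_a‖ ≤ 1 for all a. Let w, w′ ∈ ℝ^d and let W_1,…,W_J and W′_1,…,W′_J be symmetric d×d matrices satisfying K^{-2}·I ⪯ W_j and K^{-2}·I ⪯ W′_j for all j. Define y_a = x_aᵀw + Σ_{j=1}^J √(x_aᵀ W_j x_a), y′_a = x_aᵀw′ + Σ_{j=1}^J √(x_aᵀ W′_j x_a), and the softmax distributions π(a) = exp(y_a)/Σ_b exp(y_b) and π′(a) = exp(y′_a)/Σ_b exp(y′_b). Then Σ_{a∈𝒜} |π(a) − π′(a)| ≤ 3K·√(J+1) · √( ‖w − w′‖² + Σ_{j=1}^J ‖W_j − W′_j‖_F² ). -/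
open Matrix

/-- Softmax distributions whose logits differ by at most `ε`, the second having the smaller
normalizing constant, are at `ℓ¹` distance at most `2 * ε`. -/
theorem softmax_l1_le_of_partition_le {ι : Type*} [Fintype ι] [Nonempty ι] {y z : ι → ℝ} {ε : ℝ}
    (h : ∀ a, |y a - z a| ≤ ε)
    (hZ : ∑ b, Real.exp (z b) ≤ ∑ b, Real.exp (y b)) :
    ∑ a, |Real.exp (y a) / ∑ b, Real.exp (y b) - Real.exp (z a) / ∑ b, Real.exp (z b)|
      ≤ 2 * ε := by
  have hpos : ∀ u : ι → ℝ, 0 < ∑ b, Real.exp (u b) := fun u =>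
    Finset.sum_pos (fun _ _ => Real.exp_pos _) Finset.univ_nonempty
  have hsum : ∀ u : ι → ℝ, ∑ a, Real.exp (u a) / ∑ b, Real.exp (u b) = 1 := fun u => by
    rw [← Finset.sum_div, div_self (hpos u).ne']
  have hε : 0 ≤ ε := (abs_nonneg _).trans (h (Classical.arbitrary ι))
  set p : ι → ℝ := fun a => Real.exp (y a) / ∑ b, Real.exp (y b) with hp
  set q : ι → ℝ := fun a => Real.exp (z a) / ∑ b, Real.exp (z b) with hq
  have key : ∀ a, |p a - q a| ≤ 2 * ε * p a - (p a - q a) := fun a => by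
    have hp0 : 0 ≤ p a := div_nonneg (Real.exp_pos _).le (hpos y).le
    have hratio : p a * (1 - ε) ≤ q a := by
      have hexp : Real.exp (y a) * (1 - ε) ≤ Real.exp (z a) := by
        calc Real.exp (y a) * (1 - ε) ≤ Real.exp (y a) * Real.exp (-ε) := by
              gcongr
              exact Real.one_sub_le_exp_neg ε
          _ = Real.exp (y a + -ε) := (Real.exp_add _ _).symm
          _ ≤ Real.exp (z a) := Real.exp_le_exp.2 (by linarith [(abs_le.1 (h a)).2])
      calc p a * (1 - ε) = Real.exp (y a) * (1 - ε) / ∑ b, Real.exp (y b) := by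
            simp only [hp]; ring
        _ ≤ Real.exp (z a) / ∑ b, Real.exp (y b) := by
            have := hpos y
            gcongr
        _ ≤ q a := div_le_div_of_nonneg_left (Real.exp_pos _).le (hpos z) hZ
    have hεp : 0 ≤ ε * p a := mul_nonneg hε hp0
    exact abs_le.2 ⟨by linarith, by linarith⟩
  calc ∑ a, |p a - q a| ≤ ∑ a, (2 * ε * p a - (p a - q a)) := Finset.sum_le_sum fun a _ => key a
    _ = 2 * ε := by
        rw [Finset.sum_sub_distrib, Finset.sum_sub_distrib, ← Finset.mul_sum, hsum y, hsum z]
        ring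

/-- The softmax map is `2`-Lipschitz from the sup norm to the `ℓ¹` norm. -/
theorem softmax_l1_le {ι : Type*} [Fintype ι] [Nonempty ι] {y z : ι → ℝ} {ε : ℝ}
    (h : ∀ a, |y a - z a| ≤ ε) :
    ∑ a, |Real.exp (y a) / ∑ b, Real.exp (y b) - Real.exp (z a) / ∑ b, Real.exp (z b)|
      ≤ 2 * ε := by
  rcases le_total (∑ b, Real.exp (z b)) (∑ b, Real.exp (y b)) with hZ | hZ
  · exact softmax_l1_le_of_partition_le h hZ
  · simp_rw [abs_sub_comm (Real.exp (y _) / _)]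
    exact softmax_l1_le_of_partition_le (fun a => abs_sub_comm (y a) (z a) ▸ h a) hZ

/-- The Cauchy–Schwarz inequality for real dot products. -/
theorem abs_dotProduct_le_sqrt_mul_sqrt {n : Type*} [Fintype n] (u v : n → ℝ) :
    |u ⬝ᵥ v| ≤ √(∑ i, u i ^ 2) * √(∑ i, v i ^ 2) := by
  rw [← Real.sqrt_mul (Finset.sum_nonneg fun i _ => sq_nonneg (u i))]
  exact Real.abs_le_sqrt (Finset.sum_mul_sq_le_sq_mul_sq _ _ _)

/-- A quadratic form is bounded by the Frobenius norm of its matrix. -/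
theorem abs_dotProduct_mulVec_le {n : Type*} [Fintype n] (u : n → ℝ) (D : Matrix n n ℝ) :
    |u ⬝ᵥ D.mulVec u| ≤ √(∑ i, u i ^ 2) ^ 2 * √(∑ i, ∑ j, D i j ^ 2) := by
  have h := abs_dotProduct_le_sqrt_mul_sqrt (fun p : n × n => u p.1 * u p.2) (fun p => D p.1 p.2)
  have h₀ : 0 ≤ ∑ i, u i ^ 2 := Finset.sum_nonneg fun i _ => sq_nonneg (u i)
  have h₁ : ∑ p : n × n, (u p.1 * u p.2) ^ 2 = (∑ i, u i ^ 2) * ∑ i, u i ^ 2 := by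
    simp_rw [Fintype.sum_prod_type, Finset.sum_mul_sum, mul_pow]
  have h₂ : (fun p : n × n => u p.1 * u p.2) ⬝ᵥ (fun p => D p.1 p.2) = u ⬝ᵥ D.mulVec u := by
    simp only [dotProduct, mulVec, Fintype.sum_prod_type, Finset.mul_sum]
    exact Finset.sum_congr rfl fun i _ => Finset.sum_congr rfl fun j _ => by ring
  rw [h₁, h₂, Fintype.sum_prod_type, Real.sqrt_mul_self h₀] at h
  rwa [Real.sq_sqrt h₀]

/-- A lower bound `c • 1 ⪯ M` bounds the quadratic form of `M` from below. -/
theorem mul_sum_sq_le_dotProduct_mulVec {n : Type*} [Fintype n] [DecidableEq n]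
    {M : Matrix n n ℝ} {c : ℝ} (h : (M - c • (1 : Matrix n n ℝ)).PosSemidef) (u : n → ℝ) :
    c * ∑ i, u i ^ 2 ≤ u ⬝ᵥ M.mulVec u := by
  have h₁ := h.dotProduct_mulVec_nonneg u
  have h₂ : u ⬝ᵥ u = ∑ i, u i ^ 2 := by simp only [dotProduct, sq]
  simp only [star_trivial, sub_mulVec, smul_mulVec, one_mulVec, dotProduct_sub, dotProduct_smul,
    smul_eq_mul, h₂] at h₁
  linarith

/-- On the unit ball, `M ↦ √(uᵀ M u)` is `K`-Lipschitz for the Frobenius norm on the set of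
matrices bounded below by `(K ^ 2)⁻¹ • 1`. -/
theorem abs_sqrt_dotProduct_mulVec_sub_le {n : Type*} [Fintype n] [DecidableEq n]
    {M N : Matrix n n ℝ} {K : ℝ} (hK : 0 < K)
    (hM : (M - (K ^ 2)⁻¹ • (1 : Matrix n n ℝ)).PosSemidef)
    (hN : (N - (K ^ 2)⁻¹ • (1 : Matrix n n ℝ)).PosSemidef)
    {u : n → ℝ} (hu : √(∑ i, u i ^ 2) ≤ 1) :
    |√(u ⬝ᵥ M.mulVec u) - √(u ⬝ᵥ N.mulVec u)| ≤ K * √(∑ i, ∑ j, (M i j - N i j) ^ 2) := by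
  have hdiff := abs_dotProduct_mulVec_le u (M - N)
  have hs := mul_sum_sq_le_dotProduct_mulVec hM u
  have ht := mul_sum_sq_le_dotProduct_mulVec hN u
  have h₀ : 0 ≤ ∑ i, u i ^ 2 := Finset.sum_nonneg fun i _ => sq_nonneg (u i)
  rw [← Real.sq_sqrt h₀] at hs ht
  simp only [sub_mulVec, dotProduct_sub, Matrix.sub_apply] at hdiff
  set r := √(∑ i, u i ^ 2)
  set F := √(∑ i, ∑ j, (M i j - N i j) ^ 2)
  set s := u ⬝ᵥ M.mulVec u
  set t := u ⬝ᵥ N.mulVec u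
  have hr : 0 ≤ r := Real.sqrt_nonneg _
  have hF : 0 ≤ F := Real.sqrt_nonneg _
  have hs₀ : 0 ≤ s := le_trans (by positivity) hs
  have ht₀ : 0 ≤ t := le_trans (by positivity) ht
  rcases hr.eq_or_lt with hr₀ | hr₀
  · have hst : s = t := by
      rw [← hr₀] at hdiff
      exact sub_eq_zero.1 (abs_nonpos_iff.1 (by simpa using hdiff))
    rw [hst, sub_self, abs_zero]
    positivity
  · have hsqrt : r / K ≤ √s := Real.le_sqrt_of_sq_le (by rw [div_pow, div_eq_inv_mul]; exact hs)
    have hfac : |√s - √t| * (√s + √t) = |s - t| := by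
      rw [← abs_of_nonneg (add_nonneg (Real.sqrt_nonneg s) (Real.sqrt_nonneg t)), ← abs_mul]
      congr 1
      nlinarith [Real.mul_self_sqrt hs₀, Real.mul_self_sqrt ht₀]
    have hbound : |√s - √t| * (r / K) ≤ (K * F * r) * (r / K) := by
      calc |√s - √t| * (r / K) ≤ |√s - √t| * (√s + √t) := by
            gcongr
            linarith [Real.sqrt_nonneg t]
        _ ≤ r ^ 2 * F := hfac.trans_le hdiff
        _ = (K * F * r) * (r / K) := by field_simp
    exact (le_of_mul_le_mul_right hbound (by positivity)).trans
      (mul_le_of_le_one_right (by positivity) hu)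

/-- The Cauchy–Schwarz bound for a number plus a finite sum. -/
theorem add_sum_le_sqrt_card_mul_sqrt {J : ℕ} (a : ℝ) (f : Fin J → ℝ) :
    a + ∑ j, f j ≤ √(J + 1) * √(a ^ 2 + ∑ j, f j ^ 2) := by
  rw [← Real.sqrt_mul (by positivity)]
  apply Real.le_sqrt_of_sq_le
  have h := sq_sum_le_card_mul_sum_sq (s := Finset.univ) (f := (Fin.cons a f : Fin (J + 1) → ℝ))
  simpa [Fin.sum_univ_succ] using h

/-- Lipschitz bound for the softmax policy class parameterized by a linear term plus
a sum of weighted-norm bonus terms. -/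
theorem stmt_4 (𝒜 : Type*) [Fintype 𝒜] [Nonempty 𝒜]
    (d J : ℕ) (hd : 1 ≤ d) (hJ : 1 ≤ J) (K : ℝ) (hK : 1 ≤ K)
    (x : 𝒜 → Fin d → ℝ) (hx : ∀ a, Real.sqrt (∑ i, x a i ^ 2) ≤ 1)
    (w w' : Fin d → ℝ)
    (W W' : Fin J → Matrix (Fin d) (Fin d) ℝ)
    (hWsym : ∀ j, (W j).IsHermitian) (hW'sym : ∀ j, (W' j).IsHermitian)
    (hW : ∀ j, (W j - (K ^ 2)⁻¹ • (1 : Matrix (Fin d) (Fin d) ℝ)).PosSemidef)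
    (hW' : ∀ j, (W' j - (K ^ 2)⁻¹ • (1 : Matrix (Fin d) (Fin d) ℝ)).PosSemidef)
    (y y' : 𝒜 → ℝ)
    (hy : ∀ a, y a = x a ⬝ᵥ w + ∑ j, Real.sqrt (x a ⬝ᵥ (W j).mulVec (x a)))
    (hy' : ∀ a, y' a = x a ⬝ᵥ w' + ∑ j, Real.sqrt (x a ⬝ᵥ (W' j).mulVec (x a)))
    (π π' : 𝒜 → ℝ)
    (hπ : ∀ a, π a = Real.exp (y a) / ∑ b, Real.exp (y b))
    (hπ' : ∀ a, π' a = Real.exp (y' a) / ∑ b, Real.exp (y' b)) :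
    ∑ a, |π a - π' a| ≤ 3 * K * Real.sqrt (J + 1) *
      Real.sqrt ((∑ i, (w i - w' i) ^ 2)
        + ∑ j, ∑ i, ∑ i', (W j i i' - W' j i i') ^ 2) := by
  have hK₀ : 0 < K := by linarith
  have hw₀ : 0 ≤ ∑ i, (w i - w' i) ^ 2 := Finset.sum_nonneg fun i _ => sq_nonneg _
  have hF₀ : ∀ j, 0 ≤ ∑ i, ∑ i', (W j i i' - W' j i i') ^ 2 := fun j =>
    Finset.sum_nonneg fun i _ => Finset.sum_nonneg fun i' _ => sq_nonneg _
  set ρ := √((∑ i, (w i - w' i) ^ 2) + ∑ j, ∑ i, ∑ i', (W j i i' - W' j i i') ^ 2)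
  have hlogit : ∀ a, |y a - y' a| ≤ K * (√(J + 1) * ρ) := fun a => by
    have hlin : |x a ⬝ᵥ (w - w')| ≤ K * √(∑ i, (w i - w' i) ^ 2) :=
      (abs_dotProduct_le_sqrt_mul_sqrt (x a) (w - w')).trans
        (mul_le_mul_of_nonneg_right ((hx a).trans hK) (Real.sqrt_nonneg _))
    have hsplit : y a - y' a = x a ⬝ᵥ (w - w') +
        ∑ j, (√(x a ⬝ᵥ (W j).mulVec (x a)) - √(x a ⬝ᵥ (W' j).mulVec (x a))) := by
      rw [hy, hy', dotProduct_sub, Finset.sum_sub_distrib]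
      ring
    have hcs := add_sum_le_sqrt_card_mul_sqrt (√(∑ i, (w i - w' i) ^ 2))
      (fun j => √(∑ i, ∑ i', (W j i i' - W' j i i') ^ 2))
    simp only [Real.sq_sqrt hw₀, Real.sq_sqrt (hF₀ _)] at hcs
    calc |y a - y' a|
        ≤ |x a ⬝ᵥ (w - w')| +
          ∑ j, |√(x a ⬝ᵥ (W j).mulVec (x a)) - √(x a ⬝ᵥ (W' j).mulVec (x a))| := by
          rw [hsplit]
          exact (abs_add_le _ _).trans (by gcongr; exact Finset.abs_sum_le_sum_abs _ _)
      _ ≤ K * √(∑ i, (w i - w' i) ^ 2) +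
          ∑ j, K * √(∑ i, ∑ i', (W j i i' - W' j i i') ^ 2) :=
          add_le_add hlin (Finset.sum_le_sum fun j _ =>
            abs_sqrt_dotProduct_mulVec_sub_le hK₀ (hW j) (hW' j) (hx a))
      _ = K * (√(∑ i, (w i - w' i) ^ 2) +
          ∑ j, √(∑ i, ∑ i', (W j i i' - W' j i i') ^ 2)) := by rw [← Finset.mul_sum, mul_add]
      _ ≤ K * (√(J + 1) * ρ) := by gcongr
  have hnonneg : 0 ≤ K * (√(J + 1) * ρ) := by positivity
  simp_rw [hπ, hπ']
  linarith [softmax_l1_le hlogit]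
end

section
/- Let φ_1, …, φ_k ∈ ℝ^d satisfy ‖φ_i‖ ≤ 1 for all i, and let Λ = I + Σ_{i=1}^k φ_i φ_iᵀ. Then ‖ Λ^{-1} Σ_{i=1}^k φ_i ‖₂ ≤ √(d·k). -/
open Matrix

/-- If `(1 + ∑ i, φ i (φ i)ᵀ) w = ∑ i, φ i`, then pairing with `w` gives
`‖w‖² = ∑ i, (⟪φ i, w⟫ - ⟪φ i, w⟫²) ≤ k / 4`. -/
lemma dotProduct_self_le_of_one_add_sum_vecMulVec_mulVec_eq {d k : ℕ} {φ : Fin k → Fin d → ℝ}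
    {w : Fin d → ℝ} (hw : (1 + ∑ i, vecMulVec (φ i) (φ i)) *ᵥ w = ∑ i, φ i) :
    w ⬝ᵥ w ≤ k / 4 := by
  have h := congrArg (w ⬝ᵥ ·) hw
  simp only [add_mulVec, one_mulVec, sum_mulVec, vecMulVec_mulVec, dotProduct_add,
    dotProduct_sum, op_smul_eq_smul, dotProduct_smul, smul_eq_mul, dotProduct_comm _ w] at h
  have hsum : ∑ i, (w ⬝ᵥ φ i - w ⬝ᵥ φ i * w ⬝ᵥ φ i) ≤ ∑ _i : Fin k, (1 / 4 : ℝ) :=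
    Finset.sum_le_sum fun i _ => by nlinarith [sq_nonneg (w ⬝ᵥ φ i - 1 / 2)]
  rw [Finset.sum_sub_distrib] at hsum
  simp only [Finset.sum_const, Finset.card_univ, Fintype.card_fin, nsmul_eq_mul] at hsum
  linarith

lemma posDef_one_add_sum_vecMulVec_self {d k : ℕ} (φ : Fin k → Fin d → ℝ) :
    (1 + ∑ i, vecMulVec (φ i) (φ i)).PosDef :=
  PosDef.one.add_posSemidef <| posSemidef_sum _ fun i _ => by
    simpa using posSemidef_vecMulVec_self_star (φ i)

/-- Bound on the norm of the regularized least-squares weight vector: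
`‖Λ⁻¹ ∑ᵢ φᵢ‖ ≤ √(dk)` where `Λ = I + ∑ᵢ φᵢ φᵢᵀ` and `‖φᵢ‖ ≤ 1`. -/
theorem stmt_5 (d k : ℕ) (φ : Fin k → Fin d → ℝ)
    (hφ : ∀ i, Real.sqrt (∑ j, φ i j ^ 2) ≤ 1)
    (Λ : Matrix (Fin d) (Fin d) ℝ)
    (hΛ : Λ = 1 + ∑ i, Matrix.vecMulVec (φ i) (φ i)) :
    Real.sqrt (∑ j, (Λ⁻¹.mulVec (∑ i, φ i)) j ^ 2) ≤ Real.sqrt (d * k) := by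
  apply Real.sqrt_le_sqrt
  rcases Nat.eq_zero_or_pos d with rfl | hd
  · simp
  have hdet : IsUnit Λ.det := by
    rw [hΛ]
    exact (posDef_one_add_sum_vecMulVec_self φ).det_pos.ne'.isUnit
  have hw : Λ *ᵥ (Λ⁻¹ *ᵥ ∑ i, φ i) = ∑ i, φ i := by
    rw [mulVec_mulVec, mul_nonsing_inv _ hdet, one_mulVec]
  have hle : (Λ⁻¹ *ᵥ ∑ i, φ i) ⬝ᵥ (Λ⁻¹ *ᵥ ∑ i, φ i) ≤ (k : ℝ) / 4 :=
    dotProduct_self_le_of_one_add_sum_vecMulVec_mulVec_eq (by rwa [← hΛ])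
  have hd' : (1 : ℝ) ≤ d := by exact_mod_cast hd
  have hk : (0 : ℝ) ≤ k := k.cast_nonneg
  calc ∑ j, (Λ⁻¹ *ᵥ ∑ i, φ i) j ^ 2
      = (Λ⁻¹ *ᵥ ∑ i, φ i) ⬝ᵥ (Λ⁻¹ *ᵥ ∑ i, φ i) := by simp only [dotProduct, sq]
    _ ≤ (k : ℝ) / 4 := hle
    _ ≤ d * k := by nlinarith
end

section
/- Let (Ω, ℱ, P) be a probability space with a filtration (ℱ_k)_{k=0}^∞, let B > 0, and let (X_k)_{k=1}^∞ be a sequence of random variables such that each X_k is ℱ_k-measurable and takes values in [0, B]. Then for any δ ∈ (0,1), with probability at least 1 − δ, simultaneously for all integers K ≥ 1: Σ_{k=1}^K E[X_k | ℱ_{k−1}] ≤ 2·Σ_{k=1}^K X_k + 4B·log(2K/δ). -/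
open MeasureTheory Finset

lemma Real.exp_neg_le_one_sub_half {x : ℝ} (h0 : 0 ≤ x) (h1 : x ≤ 1) :
    Real.exp (-x) ≤ 1 - x / 2 := by
  rw [Real.exp_neg]
  have h : 1 + x ≤ Real.exp x := by linarith [Real.add_one_le_exp x]
  calc (Real.exp x)⁻¹ ≤ (1 + x)⁻¹ := by gcongr
    _ ≤ 1 - x / 2 := by
      rw [inv_le_iff_one_le_mul₀ (by linarith)]
      nlinarith

/-- If `X` takes values in `[0, 1]` and `W ≥ 0` is bounded and `m`-measurable, then
`E[W exp (E[X | m] / 2 - X)] ≤ E[W]`. -/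
lemma integral_mul_exp_half_condExp_sub_le {Ω : Type*} {m m0 : MeasurableSpace Ω}
    {μ : Measure Ω} [IsProbabilityMeasure μ] (hm : m ≤ m0) {X W : Ω → ℝ}
    (hX : Measurable X) (hX01 : ∀ ω, X ω ∈ Set.Icc (0 : ℝ) 1)
    (hY1 : ∀ᵐ ω ∂μ, (μ[X | m]) ω ≤ 1)
    (hW : StronglyMeasurable[m] W) (hW0 : ∀ ω, 0 ≤ W ω) {C : ℝ} (hWC : ∀ᵐ ω ∂μ, W ω ≤ C) :
    ∫ ω, W ω * Real.exp ((μ[X | m]) ω / 2 - X ω) ∂μ ≤ ∫ ω, W ω ∂μ := by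
  set Y := μ[X | m] with hY
  have hYm : StronglyMeasurable[m] Y := stronglyMeasurable_condExp
  have hXi : Integrable X μ := .of_bound hX.aestronglyMeasurable 1 <| .of_forall fun ω => by
    rw [Real.norm_of_nonneg (hX01 ω).1]; exact (hX01 ω).2
  have hWi : Integrable W μ := .of_bound (hW.mono hm).aestronglyMeasurable C <| by
    filter_upwards [hWC] with ω h
    rwa [Real.norm_of_nonneg (hW0 ω)]
  set V : Ω → ℝ := fun ω => W ω * Real.exp (Y ω / 2) with hV
  have hVm : StronglyMeasurable[m] V :=
    hW.mul (Real.continuous_exp.comp_stronglyMeasurable (hYm.div stronglyMeasurable_const))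
  have hVb : ∀ᵐ ω ∂μ, ‖V ω‖ ≤ C * Real.exp (1 / 2) := by
    filter_upwards [hWC, hY1] with ω h1 h2
    rw [Real.norm_of_nonneg (mul_nonneg (hW0 ω) (Real.exp_pos _).le)]
    have := (hW0 ω).trans h1
    gcongr
  have hVi : Integrable V μ := .of_bound (hVm.mono hm).aestronglyMeasurable _ hVb
  have hVX : Integrable (V * X) μ := hXi.bdd_mul (hVm.mono hm).aestronglyMeasurable hVb
  have hVY : Integrable (V * Y) μ :=
    integrable_condExp.bdd_mul (hVm.mono hm).aestronglyMeasurable hVb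
  have hswap : ∫ ω, (V * X) ω ∂μ = ∫ ω, (V * Y) ω ∂μ := by
    rw [← integral_condExp hm]
    exact integral_congr_ae (condExp_mul_of_stronglyMeasurable_left hVm hVX hXi)
  calc ∫ ω, W ω * Real.exp (Y ω / 2 - X ω) ∂μ ≤ ∫ ω, (V ω - (V * X) ω / 2) ∂μ := by
        refine integral_mono_of_nonneg
          (.of_forall fun ω => mul_nonneg (hW0 ω) (Real.exp_pos _).le)
          (hVi.sub (hVX.div_const 2)) (.of_forall fun ω => ?_)
        have h := Real.exp_neg_le_one_sub_half (hX01 ω).1 (hX01 ω).2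
        have hV0 : 0 ≤ V ω := mul_nonneg (hW0 ω) (Real.exp_pos _).le
        calc W ω * Real.exp (Y ω / 2 - X ω) = V ω * Real.exp (-X ω) := by
              rw [sub_eq_add_neg, Real.exp_add, ← mul_assoc]
          _ ≤ V ω * (1 - X ω / 2) := by gcongr
          _ = V ω - (V * X) ω / 2 := by simp only [Pi.mul_apply]; ring
    _ = ∫ ω, (V ω - (V * Y) ω / 2) ∂μ := by
        rw [integral_sub hVi (hVX.div_const 2), integral_sub hVi (hVY.div_const 2),
          integral_div, integral_div, hswap]
    _ ≤ ∫ ω, W ω ∂μ := by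
        refine integral_mono (hVi.sub (hVY.div_const 2)) hWi fun ω => ?_
        have h : 1 - Y ω / 2 ≤ Real.exp (-(Y ω / 2)) := by
          linarith [Real.add_one_le_exp (-(Y ω / 2))]
        have hV0 : 0 ≤ V ω := mul_nonneg (hW0 ω) (Real.exp_pos _).le
        calc V ω - (V * Y) ω / 2 = V ω * (1 - Y ω / 2) := by
              simp only [Pi.mul_apply]; ring
          _ ≤ V ω * Real.exp (-(Y ω / 2)) := by gcongr
          _ = W ω := by
              rw [hV, mul_assoc, ← Real.exp_add, add_neg_cancel, Real.exp_zero, mul_one]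

/-- The exponential process `exp (∑ k, (E[X k | ℱ (k - 1)] / 2 - X k))` of a `[0, 1]`-valued
adapted sequence is integrable with mean at most `1`. -/
lemma integrable_and_integral_exp_sum_half_condExp_sub_le_one {Ω : Type*}
    {m0 : MeasurableSpace Ω} {μ : Measure Ω} [IsProbabilityMeasure μ] (ℱ : Filtration ℕ m0)
    {X : ℕ → Ω → ℝ} (hX : ∀ k, Measurable[ℱ k] (X k))
    (hX01 : ∀ k ω, X k ω ∈ Set.Icc (0 : ℝ) 1) (K : ℕ) :
    Integrable (fun ω => Real.exp (∑ k ∈ Icc 1 K, ((μ[X k | ℱ (k - 1)]) ω / 2 - X k ω))) μ ∧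
      ∫ ω, Real.exp (∑ k ∈ Icc 1 K, ((μ[X k | ℱ (k - 1)]) ω / 2 - X k ω)) ∂μ ≤ 1 := by
  have hXi (k) : Integrable (X k) μ :=
    .of_bound ((hX k).mono (ℱ.le k) le_rfl).aestronglyMeasurable 1 <| .of_forall fun ω => by
      rw [Real.norm_of_nonneg (hX01 k ω).1]; exact (hX01 k ω).2
  have hY1 (k) : ∀ᵐ ω ∂μ, (μ[X k | ℱ (k - 1)]) ω ≤ 1 := by
    have h := condExp_mono (m := ℱ (k - 1)) (hXi k) (integrable_const (1 : ℝ))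
      (.of_forall fun ω => (hX01 k ω).2)
    rwa [condExp_const (ℱ.le _)] at h
  have hmeas (K) : StronglyMeasurable[ℱ K]
      (fun ω => Real.exp (∑ k ∈ Icc 1 K, ((μ[X k | ℱ (k - 1)]) ω / 2 - X k ω))) := by
    refine Real.continuous_exp.comp_stronglyMeasurable
      (Finset.stronglyMeasurable_fun_sum _ fun k hk => ?_)
    have hk := (mem_Icc.1 hk).2
    exact ((stronglyMeasurable_condExp.mono (ℱ.mono (by omega))).div stronglyMeasurable_const).sub
      ((hX k).stronglyMeasurable.mono (ℱ.mono hk))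
  have hbound (K : ℕ) : ∀ᵐ ω ∂μ,
      Real.exp (∑ k ∈ Icc 1 K, ((μ[X k | ℱ (k - 1)]) ω / 2 - X k ω)) ≤ Real.exp K := by
    filter_upwards [ae_all_iff.2 hY1] with ω h
    gcongr
    calc ∑ k ∈ Icc 1 K, ((μ[X k | ℱ (k - 1)]) ω / 2 - X k ω) ≤ ∑ k ∈ Icc 1 K, (1 : ℝ) :=
          sum_le_sum fun k _ => by linarith [h k, (hX01 k ω).1]
      _ = K := by simp
  refine ⟨.of_bound ((hmeas K).mono (ℱ.le K)).aestronglyMeasurable (Real.exp K) ?_, ?_⟩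
  · filter_upwards [hbound K] with ω h
    rwa [Real.norm_of_nonneg (Real.exp_pos _).le]
  · induction K with
    | zero => simp
    | succ K ih =>
      refine le_trans ?_ ih
      have h := integral_mul_exp_half_condExp_sub_le (μ := μ) (ℱ.le K)
        ((hX (K + 1)).mono (ℱ.le _) le_rfl) (hX01 (K + 1)) (hY1 (K + 1)) (hmeas K)
        (fun ω => (Real.exp_pos _).le) (hbound K)
      simpa only [sum_Icc_succ_top (Nat.le_add_left 1 K), Real.exp_add,
        Nat.add_sub_cancel] using h

lemma tsum_ofReal_sq_le {δ : ℝ} (hδ : 0 < δ) (hδ1 : δ < 1) :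
    ∑' K : ℕ, ENNReal.ofReal ((δ / 2) ^ 2 * (1 / (K : ℝ) ^ 2)) ≤ ENNReal.ofReal δ := by
  have hs := hasSum_zeta_two.mul_left ((δ / 2) ^ 2)
  rw [← ENNReal.ofReal_tsum_of_nonneg (fun K => by positivity) hs.summable, hs.tsum_eq]
  refine ENNReal.ofReal_le_ofReal ?_
  have hpi : Real.pi ^ 2 ≤ 16 := by nlinarith [Real.pi_le_four, Real.pi_pos]
  nlinarith [mul_le_mul_of_nonneg_left hpi (sq_nonneg δ)]

/-- Martingale-type concentration: for an adapted sequence `(X_k)` with values in `[0, B]`,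
with probability at least `1 - δ`, simultaneously for all `K ≥ 1`:
`∑_{k=1}^K E[X_k | ℱ_{k-1}] ≤ 2 ∑_{k=1}^K X_k + 4B log(2K/δ)`. -/
theorem stmt_10 {Ω : Type*} {m0 : MeasurableSpace Ω}
    (μ : Measure Ω) [IsProbabilityMeasure μ]
    (ℱ : Filtration ℕ m0)
    (B : ℝ) (hB : 0 < B)
    (X : ℕ → Ω → ℝ)
    (hmeas : ∀ k, Measurable[ℱ k] (X k))
    (hbdd : ∀ k ω, X k ω ∈ Set.Icc (0 : ℝ) B)
    (δ : ℝ) (hδ : 0 < δ) (hδ1 : δ < 1) :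
    ENNReal.ofReal (1 - δ) ≤
      μ {ω | ∀ K : ℕ, 1 ≤ K →
        ∑ k ∈ Finset.Icc 1 K, (μ[X k | ℱ (k - 1)]) ω ≤
          2 * ∑ k ∈ Finset.Icc 1 K, X k ω + 4 * B * Real.log (2 * K / δ)} := by
  set S := {ω | ∀ K : ℕ, 1 ≤ K →
        ∑ k ∈ Finset.Icc 1 K, (μ[X k | ℱ (k - 1)]) ω ≤
          2 * ∑ k ∈ Finset.Icc 1 K, X k ω + 4 * B * Real.log (2 * K / δ)} with hS
  set U : ℕ → Ω → ℝ := fun k => B⁻¹ • X k with hU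
  set M : ℕ → Ω → ℝ := fun K ω =>
    Real.exp (∑ k ∈ Icc 1 K, ((μ[U k | ℱ (k - 1)]) ω / 2 - U k ω)) with hM
  have hMK (K) : Integrable (M K) μ ∧ ∫ ω, M K ω ∂μ ≤ 1 :=
    integrable_and_integral_exp_sum_half_condExp_sub_le_one ℱ
      (fun k => (hmeas k).const_smul B⁻¹)
      (fun k ω => by
        have := hbdd k ω
        simp only [Pi.smul_apply, smul_eq_mul, Set.mem_Icc]
        exact ⟨mul_nonneg (by positivity) this.1,
          by rw [inv_mul_le_iff₀ hB]; simpa using this.2⟩) K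
  have hscale : ∀ᵐ ω ∂μ, ∀ k, (μ[U k | ℱ (k - 1)]) ω = B⁻¹ * (μ[X k | ℱ (k - 1)]) ω :=
    ae_all_iff.2 fun k => condExp_smul B⁻¹ (X k) (ℱ (k - 1))
  set T : ℕ → Set Ω := fun K => {ω | 1 ≤ K ∧ (2 * K / δ) ^ 2 ≤ M K ω} with hT
  have hTK (K : ℕ) : μ (T K) ≤ ENNReal.ofReal ((δ / 2) ^ 2 * (1 / (K : ℝ) ^ 2)) := by
    rcases Nat.eq_zero_or_pos K with rfl | hK
    · simp [hT]
    have hK' : (0 : ℝ) < K := by exact_mod_cast hK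
    have hmarkov := mul_meas_ge_le_integral_of_nonneg
      (.of_forall fun ω => (Real.exp_pos _).le) (hMK K).1 ((2 * K / δ) ^ 2)
    have hle : μ.real {ω | (2 * K / δ) ^ 2 ≤ M K ω} ≤ (δ / 2) ^ 2 * (1 / (K : ℝ) ^ 2) := by
      have h := hmarkov.trans (hMK K).2
      rw [mul_comm, ← le_div_iff₀ (by positivity)] at h
      refine h.trans_eq ?_
      field_simp
    calc μ (T K) ≤ μ {ω | (2 * K / δ) ^ 2 ≤ M K ω} := measure_mono fun ω h => h.2
      _ = ENNReal.ofReal (μ.real {ω | (2 * K / δ) ^ 2 ≤ M K ω}) := by simp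
      _ ≤ _ := ENNReal.ofReal_le_ofReal hle
  have hsub : Sᶜ ≤ᵐ[μ] (⋃ K, T K : Set Ω) := by
    filter_upwards [hscale] with ω hω hωS
    have hωS : ω ∉ S := hωS
    simp only [hS, Set.mem_ofPred_eq, not_forall, not_le] at hωS
    obtain ⟨K, hK, hlt⟩ := hωS
    refine Set.mem_iUnion.2 ⟨K, hK, ?_⟩
    have hK' : (0 : ℝ) < K := by exact_mod_cast hK
    rw [← Real.log_le_iff_le_exp (by positivity), Real.log_pow]
    have hsum : ∑ k ∈ Icc 1 K, ((μ[U k | ℱ (k - 1)]) ω / 2 - U k ω) =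
        (∑ k ∈ Icc 1 K, (μ[X k | ℱ (k - 1)]) ω - 2 * ∑ k ∈ Icc 1 K, X k ω) / (2 * B) := by
      rw [mul_sum, ← sum_sub_distrib, sum_div]
      refine sum_congr rfl fun k _ => ?_
      rw [hω k]
      simp only [hU, Pi.smul_apply, smul_eq_mul]
      field_simp
    rw [hsum, le_div_iff₀ (by positivity)]
    push_cast
    linarith
  have hcompl : μ Sᶜ ≤ ENNReal.ofReal δ :=
    calc μ Sᶜ ≤ μ (⋃ K, T K) := measure_mono_ae hsub
      _ ≤ ∑' K, μ (T K) := measure_iUnion_le _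
      _ ≤ _ := (ENNReal.tsum_le_tsum hTK).trans (tsum_ofReal_sq_le hδ hδ1)
  rw [ENNReal.ofReal_sub _ hδ.le, ENNReal.ofReal_one, tsub_le_iff_right]
  calc 1 = μ (S ∪ Sᶜ) := by rw [Set.union_compl_self, measure_univ]
    _ ≤ μ S + μ Sᶜ := measure_union_le _ _
    _ ≤ μ S + ENNReal.ofReal δ := by gcongr
end

section
/- Let 𝒜 be a nonempty finite set, p ≥ 1 an integer, and L ≥ 0. For each a ∈ 𝒜 let u_a : ℝ^p → ℝ be differentiable with ‖∇u_a(θ)‖ ≤ L for all θ ∈ ℝ^p. For θ ∈ ℝ^p define π^θ(a) = exp(u_a(θ))/Σ_{b∈𝒜} exp(u_b(θ)). Then for every a ∈ 𝒜 the map θ ↦ π^θ(a) is differentiable, and for all θ: ‖∇_θ π^θ(a)‖ ≤ 2L·π^θ(a). -/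
/-- The softmax weight of `a` as the inverse of a sum of exponentials of logit differences. -/
theorem softmax_eq_inv_sum_exp_sub {ι : Type*} [Fintype ι] (v : ι → ℝ) (a : ι) :
    Real.exp (v a) / ∑ b, Real.exp (v b) = (∑ b, Real.exp (v b - v a))⁻¹ := by
  simp_rw [Real.exp_sub, ← Finset.sum_div, inv_div]

theorem hasFDerivAt_softmax {ι E : Type*} [Fintype ι] [Nonempty ι] [NormedAddCommGroup E]
    [NormedSpace ℝ E] {u : ι → E → ℝ} {u' : ι → E →L[ℝ] ℝ} {x : E}
    (hu : ∀ b, HasFDerivAt (u b) (u' b) x) (a : ι) :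
    HasFDerivAt (fun y => Real.exp (u a y) / ∑ b, Real.exp (u b y))
      (-((∑ b, Real.exp (u b x - u a x)) ^ 2)⁻¹ •
        ∑ b, Real.exp (u b x - u a x) • (u' b - u' a)) x := by
  simp_rw [fun y => softmax_eq_inv_sum_exp_sub (fun b => u b y) a]
  have hpos : 0 < ∑ b, Real.exp (u b x - u a x) :=
    Finset.sum_pos (fun b _ => Real.exp_pos _) Finset.univ_nonempty
  have hsum : HasFDerivAt (fun y => ∑ b, Real.exp (u b y - u a y))
      (∑ b, Real.exp (u b x - u a x) • (u' b - u' a)) x :=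
    HasFDerivAt.fun_sum fun b _ => ((hu b).sub (hu a)).exp
  exact (hasDerivAt_inv hpos.ne').comp_hasFDerivAt x hsum

theorem norm_fderiv_softmax_le {ι E : Type*} [Fintype ι] [Nonempty ι] [NormedAddCommGroup E]
    [NormedSpace ℝ E] {u : ι → E → ℝ} {x : E} {L : ℝ}
    (hu : ∀ b, DifferentiableAt ℝ (u b) x) (hL : ∀ b, ‖fderiv ℝ (u b) x‖ ≤ L) (a : ι) :
    ‖fderiv ℝ (fun y => Real.exp (u a y) / ∑ b, Real.exp (u b y)) x‖ ≤
      2 * L * (Real.exp (u a x) / ∑ b, Real.exp (u b x)) := by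
  rw [(hasFDerivAt_softmax (fun b => (hu b).hasFDerivAt) a).fderiv,
    softmax_eq_inv_sum_exp_sub (fun b => u b x) a]
  set S := ∑ b, Real.exp (u b x - u a x) with hS
  have hpos : 0 < S := Finset.sum_pos (fun b _ => Real.exp_pos _) Finset.univ_nonempty
  have hsum : ‖∑ b, Real.exp (u b x - u a x) • (fderiv ℝ (u b) x - fderiv ℝ (u a) x)‖ ≤
      S * (2 * L) := by
    rw [hS, Finset.sum_mul]
    refine norm_sum_le_of_le _ fun b _ => ?_
    rw [norm_smul, Real.norm_of_nonneg (Real.exp_pos _).le]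
    gcongr
    linarith [norm_sub_le (fderiv ℝ (u b) x) (fderiv ℝ (u a) x), hL a, hL b]
  rw [norm_smul, norm_neg, Real.norm_of_nonneg (by positivity)]
  calc (S ^ 2)⁻¹ * _ ≤ (S ^ 2)⁻¹ * (S * (2 * L)) := by gcongr
    _ = 2 * L * S⁻¹ := by field_simp

theorem norm_gradient_eq_norm_fderiv {E : Type*} [NormedAddCommGroup E] [InnerProductSpace ℝ E]
    [CompleteSpace E] (f : E → ℝ) (x : E) : ‖gradient f x‖ = ‖fderiv ℝ f x‖ :=
  LinearIsometryEquiv.norm_map _ _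

/-- If the logits `u_a` are differentiable with gradients bounded in norm by `L`,
then each softmax probability `π^θ(a)` is differentiable with
`‖∇_θ π^θ(a)‖ ≤ 2L π^θ(a)`. -/
theorem stmt_14 (𝒜 : Type*) [Fintype 𝒜] [Nonempty 𝒜]
    (p : ℕ) (hp : 1 ≤ p) (L : ℝ) (hL : 0 ≤ L)
    (u : 𝒜 → EuclideanSpace ℝ (Fin p) → ℝ)
    (hdiff : ∀ a, Differentiable ℝ (u a))
    (hgrad : ∀ a θ, ‖gradient (u a) θ‖ ≤ L)
    (π : EuclideanSpace ℝ (Fin p) → 𝒜 → ℝ)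
    (hπ : ∀ θ a, π θ a = Real.exp (u a θ) / ∑ b, Real.exp (u b θ))
    (a : 𝒜) :
    Differentiable ℝ (fun θ => π θ a) ∧
      ∀ θ, ‖gradient (fun θ => π θ a) θ‖ ≤ 2 * L * π θ a := by
  have hfun : (fun θ => π θ a) = fun θ => Real.exp (u a θ) / ∑ b, Real.exp (u b θ) :=
    funext fun θ => hπ θ a
  rw [hfun]
  refine ⟨fun θ => (hasFDerivAt_softmax (fun b => (hdiff b θ).hasFDerivAt) a).differentiableAt,
    fun θ => ?_⟩
  rw [norm_gradient_eq_norm_fderiv, hπ]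
  exact norm_fderiv_softmax_le (fun b => hdiff b θ)
    (fun b => norm_gradient_eq_norm_fderiv (u b) θ ▸ hgrad b θ) a
end
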